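/- Let T be a triangulated category with countable coproducts and a t-structure, and suppose there is an integer r > 0 such that any countable coproduct of objects of T^{≥0} lies in T^{≥ -r}. If A_* is a sequence in T such that for every integer n the sequence of truncations A_*^{≤ n} eventually stabilizes, then for each n the natural map colim A_*^{≤ n} → (hocolim A_*)^{≤ n} is an isomorphism. -/

import Mathlib

open CategoryTheory CategoryTheory.Limits CategoryTheory.Pretriangulated ZeroObject

universe v u v₂ u₂

namespace Paper

variable (T : Type u) [Category.{v} T] [HasZeroObject T] [HasShift T ℤ]
  [Preadditive T] [∀ n : ℤ, (shiftFunctor T n).Additive] [Pretriangulated T]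

/-- A t-structure on the triangulated category `T`, packaged together with a choice of
truncation functors and of the natural maps between them. -/
structure TData : Type (max u v) where
  le : ℤ → Set T
  ge : ℤ → Set T
  le_iso : ∀ n ⦃X Y : T⦄, (X ≅ Y) → X ∈ le n → Y ∈ le n
  ge_iso : ∀ n ⦃X Y : T⦄, (X ≅ Y) → X ∈ ge n → Y ∈ ge n
  le_mono : ∀ ⦃n m : ℤ⦄, n ≤ m → le n ⊆ le m
  ge_anti : ∀ ⦃n m : ℤ⦄, n ≤ m → ge m ⊆ ge n
  le_shift : ∀ (n : ℤ) ⦃X : T⦄, X ∈ le n → X⟦(1 : ℤ)⟧ ∈ le (n - 1)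
  ge_shift : ∀ (n : ℤ) ⦃X : T⦄, X ∈ ge n → X⟦(1 : ℤ)⟧ ∈ ge (n - 1)
  hom_zero : ∀ ⦃n m : ℤ⦄, n < m → ∀ ⦃X Y : T⦄, X ∈ le n → Y ∈ ge m →
    ∀ f : X ⟶ Y, f = 0
  truncLE : ℤ → T ⥤ T
  truncGE : ℤ → T ⥤ T
  truncLEπ : ∀ n, truncLE n ⟶ 𝟭 T
  truncGEι : ∀ n, 𝟭 T ⟶ truncGE n
  truncLE_mem : ∀ n X, (truncLE n).obj X ∈ le n
  truncGE_mem : ∀ n X, (truncGE n).obj X ∈ ge n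
  trunc_triangle : ∀ (n : ℤ) (X : T), ∃ h,
    Triangle.mk ((truncLEπ n).app X) ((truncGEι (n + 1)).app X) h ∈ distTriang T
  truncLEle : ∀ ⦃n m : ℤ⦄, n ≤ m → (truncLE n ⟶ truncLE m)
  truncLEle_refl : ∀ n : ℤ, truncLEle (le_refl n) = 𝟙 (truncLE n)
  truncLEle_trans : ∀ ⦃n m k : ℤ⦄ (h₁ : n ≤ m) (h₂ : m ≤ k),
    truncLEle h₁ ≫ truncLEle h₂ = truncLEle (h₁.trans h₂)
  truncLEle_π : ∀ ⦃n m : ℤ⦄ (h : n ≤ m), truncLEle h ≫ truncLEπ m = truncLEπ n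

variable [HasColimitsOfShape (Discrete ℕ) T]

/-- The "shift by one" endomorphism of `⊕ᵢ Aᵢ` for a sequence `A`, whose components are
`Aᵢ ⟶ A_{i+1} ⟶ ⊕ᵢ Aᵢ`. -/
noncomputable def seqShift (A : ℕ ⥤ T) : (∐ fun i => A.obj i) ⟶ ∐ fun i => A.obj i :=
  Sigma.desc fun i => A.map (homOfLE (Nat.le_succ i)) ≫ Sigma.ι (fun i => A.obj i) (i + 1)

/-- `π : ⊕ᵢ Aᵢ ⟶ X` exhibits `X` as the homotopy colimit of the sequence `A`: the map
`1 − shift` followed by `π` extends to a distinguished triangle. -/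
def IsHocolim (A : ℕ ⥤ T) (X : T) (π : (∐ fun i => A.obj i) ⟶ X) : Prop :=
  ∃ w, Triangle.mk (𝟙 (∐ fun i => A.obj i) - seqShift T A) π w ∈ distTriang T

section

set_option linter.unusedSectionVars false

variable {T}

/-- Surjectivity of `1 - shift` on `Hom(⊕ᵢ Cᵢ, D)` for an eventually constant sequence. -/
lemma exists_sub_comp_eq {D : T} (K : ℕ) : ∀ (C : ℕ → T) (a : ∀ i, C i ⟶ C (i + 1))
    (_ : ∀ i, K ≤ i → IsIso (a i)) (g : ∀ i, C i ⟶ D),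
    ∃ h : ∀ i, C i ⟶ D, ∀ i, h i - a i ≫ h (i + 1) = g i := by
  induction K with
  | zero =>
    intro C a ha g
    have : ∀ i, IsIso (a i) := fun i => ha i (Nat.zero_le i)
    refine ⟨fun i => Nat.rec (motive := fun i => C i ⟶ D) 0
      (fun i f => inv (a i) ≫ (f - g i)) i, fun i => ?_⟩
    simp
  | succ K ih =>
    intro C a ha g
    obtain ⟨h, hh⟩ := ih (fun i => C (i + 1)) (fun i => a (i + 1))
      (fun i hi => ha (i + 1) (by lia)) (fun i => g (i + 1))
    refine ⟨fun i => Nat.casesOn (motive := fun i => C i ⟶ D) i (g 0 + a 0 ≫ h 0) h, fun i => ?_⟩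
    cases i with
    | zero => simp
    | succ i => exact hh i

lemma ι_seqShift (A : ℕ ⥤ T) (i : ℕ) :
    Sigma.ι (fun i => A.obj i) i ≫ seqShift T A =
      A.map (homOfLE (Nat.le_succ i)) ≫ Sigma.ι (fun i => A.obj i) (i + 1) := by
  simp [seqShift]

/-- A morphism killed by `1 - shift` is a cocone on the sequence. -/
lemma ι_comp_eq_of_sub_seqShift_comp_eq_zero (A : ℕ ⥤ T) {D : T}
    (f : (∐ fun i => A.obj i) ⟶ D) (hf : (𝟙 _ - seqShift T A) ≫ f = 0)
    {i j : ℕ} (hij : i ≤ j) :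
    A.map (homOfLE hij) ≫ Sigma.ι (fun i => A.obj i) j ≫ f = Sigma.ι (fun i => A.obj i) i ≫ f := by
  induction j, hij using Nat.le_induction with
  | base => simp
  | succ j hij ih =>
    have h := Sigma.ι (fun i => A.obj i) j ≫= hf
    rw [Preadditive.sub_comp, Preadditive.comp_sub, reassoc_of% ι_seqShift, comp_zero, sub_eq_zero,
      Category.id_comp] at h
    rw [← ih, h, ← Functor.map_comp_assoc, homOfLE_comp]

/-- For a sequence which is constant from `K` on, the sequence
`⊕ᵢ Cᵢ ⟶ ⊕ᵢ Cᵢ ⟶ C_K` given by `1 - shift` is split exact, and `C_K` is a colimit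
of the sequence. -/
lemma exists_splitting_of_stable (C : ℕ ⥤ T) (K : ℕ)
    (hK : ∀ i j : ℕ, K ≤ i → ∀ h : i ≤ j, IsIso (C.map (homOfLE h))) :
    ∃ (c : (∐ fun i => C.obj i) ⟶ C.obj K) (h : (∐ fun i => C.obj i) ⟶ ∐ fun i => C.obj i),
      Sigma.ι (fun i => C.obj i) K ≫ c = 𝟙 _ ∧ (𝟙 _ - seqShift T C) ≫ c = 0 ∧
      (𝟙 _ - seqShift T C) ≫ h = 𝟙 _ ∧
      ∀ {D : T} (f : (∐ fun i => C.obj i) ⟶ D), (𝟙 _ - seqShift T C) ≫ f = 0 →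
        c ≫ Sigma.ι (fun i => C.obj i) K ≫ f = f := by
  obtain ⟨h, hh⟩ := exists_sub_comp_eq K (fun i => C.obj i)
    (fun i => C.map (homOfLE (Nat.le_succ i))) (fun i hi => hK i (i + 1) hi _)
    (fun i => Sigma.ι (fun i => C.obj i) i)
  have hd : (𝟙 _ - seqShift T C) ≫ Sigma.desc h = 𝟙 _ := by
    refine Sigma.hom_ext _ _ fun i => ?_
    rw [Preadditive.sub_comp, Preadditive.comp_sub, reassoc_of% ι_seqShift]
    simpa using hh i
  have iso : ∀ j (hj : K ≤ j), IsIso (C.map (homOfLE hj)) := fun j hj => hK K j le_rfl hj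
  let c : ∀ i, C.obj i ⟶ C.obj K := fun i =>
    have := iso (max i K) (le_max_right i K)
    C.map (homOfLE (le_max_left i K)) ≫ inv (C.map (homOfLE (le_max_right i K)))
  have hc : ∀ i j (hi : i ≤ j) (hj : K ≤ j),
      c i ≫ C.map (homOfLE hj) = C.map (homOfLE hi) := fun i j hi hj => by
    rw [← homOfLE_comp (le_max_right i K) (max_le hi hj), C.map_comp]
    simp only [c, Category.assoc, IsIso.inv_hom_id_assoc]
    rw [← C.map_comp, homOfLE_comp]
  refine ⟨Sigma.desc c, Sigma.desc h, ?_, ?_, hd, fun f hf => ?_⟩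
  · have := hc K K le_rfl le_rfl
    simpa using this
  · refine Sigma.hom_ext _ _ fun i => ?_
    have := iso (max (i + 1) K) (le_max_right _ _)
    rw [← cancel_mono (C.map (homOfLE (le_max_right (i + 1) K)))]
    rw [Preadditive.sub_comp, Preadditive.comp_sub, reassoc_of% ι_seqShift]
    simp only [Category.id_comp, Sigma.ι_desc, Preadditive.sub_comp, Category.assoc, comp_zero,
      zero_comp]
    rw [hc _ _ (by lia), hc _ _ (le_max_left _ _), ← C.map_comp, homOfLE_comp, sub_self]
  · refine Sigma.hom_ext _ _ fun i => ?_
    rw [Sigma.ι_desc_assoc,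
      ← ι_comp_eq_of_sub_seqShift_comp_eq_zero C _ hf (le_max_right i K),
      reassoc_of% hc i _ (le_max_left i K) (le_max_right i K),
      ι_comp_eq_of_sub_seqShift_comp_eq_zero C _ hf]

/-- The shift of a countable coproduct has the universal property of the coproduct of the
shifts. -/
noncomputable def shiftSigmaIsColimit (X : ℕ → T) :
    IsColimit (Cofan.mk ((∐ X)⟦(1 : ℤ)⟧) fun i => (Sigma.ι X i)⟦(1 : ℤ)⟧') :=
  isColimitCofanMkObjOfIsColimit (shiftFunctor T (1 : ℤ)) _ _ (coproductIsCoproduct X)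

/-- The shift of a countable coproduct is isomorphic to the coproduct of the shifts. -/
noncomputable def shiftSigmaIso (X : ℕ → T) :
    (∐ X)⟦(1 : ℤ)⟧ ≅ ∐ fun i => (X i)⟦(1 : ℤ)⟧ :=
  (shiftSigmaIsColimit X).coconePointUniqueUpToIso
    (coproductIsCoproduct fun i => (X i)⟦(1 : ℤ)⟧)

lemma shift_sigma_hom_ext {X : ℕ → T} {W : T} {f g : (∐ X)⟦(1 : ℤ)⟧ ⟶ W}
    (h : ∀ i, (Sigma.ι X i)⟦(1 : ℤ)⟧' ≫ f = (Sigma.ι X i)⟦(1 : ℤ)⟧' ≫ g) : f = g :=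
  Cofan.IsColimit.hom_ext (shiftSigmaIsColimit X) _ _ h

lemma exists_shift_sigma_desc {X : ℕ → T} {W : T} (f : ∀ i, (X i)⟦(1 : ℤ)⟧ ⟶ W) :
    ∃ g : (∐ X)⟦(1 : ℤ)⟧ ⟶ W, ∀ i, (Sigma.ι X i)⟦(1 : ℤ)⟧' ≫ g = f i :=
  ⟨Cofan.IsColimit.desc (shiftSigmaIsColimit X) f,
    Cofan.IsColimit.fac (shiftSigmaIsColimit X) f⟩

section

variable {X Y Z W : T} {f : X ⟶ Y} {g : Y ⟶ Z} {h : Z ⟶ X⟦(1 : ℤ)⟧}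

lemma comp_eq_zero₁₂ (hT : Triangle.mk f g h ∈ distTriang T) : f ≫ g = 0 :=
  comp_distTriang_mor_zero₁₂ _ hT

lemma comp_eq_zero₃₁ (hT : Triangle.mk f g h ∈ distTriang T) : h ≫ f⟦(1 : ℤ)⟧' = 0 :=
  comp_distTriang_mor_zero₃₁ _ hT

lemma exists_eq_mor₂_comp (hT : Triangle.mk f g h ∈ distTriang T) (y : Y ⟶ W) (hy : f ≫ y = 0) :
    ∃ z : Z ⟶ W, y = g ≫ z :=
  Triangle.yoneda_exact₂ _ hT y hy

lemma exists_eq_mor₃_comp (hT : Triangle.mk f g h ∈ distTriang T) (z : Z ⟶ W) (hz : g ≫ z = 0) :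
    ∃ x : X⟦(1 : ℤ)⟧ ⟶ W, z = h ≫ x :=
  Triangle.yoneda_exact₃ _ hT z hz

lemma exists_eq_shift_mor₁_comp (hT : Triangle.mk f g h ∈ distTriang T) (x : X⟦(1 : ℤ)⟧ ⟶ W)
    (hx : h ≫ x = 0) : ∃ y : Y⟦(1 : ℤ)⟧ ⟶ W, x = f⟦(1 : ℤ)⟧' ≫ y := by
  obtain ⟨y, hy⟩ := Triangle.yoneda_exact₃ _ (rot_of_distTriang _ hT) x hx
  exact ⟨-y, hy.trans ((Preadditive.neg_comp _ _).trans (Preadditive.comp_neg _ _).symm)⟩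

lemma exists_eq_comp_mor₁ (hT : Triangle.mk f g h ∈ distTriang T) (y : W ⟶ Y) (hy : y ≫ g = 0) :
    ∃ x : W ⟶ X, y = x ≫ f :=
  Triangle.coyoneda_exact₂ _ hT y hy

lemma exists_eq_comp_mor₂ (hT : Triangle.mk f g h ∈ distTriang T) (z : W ⟶ Z) (hz : z ≫ h = 0) :
    ∃ y : W ⟶ Y, z = y ≫ g :=
  Triangle.coyoneda_exact₃ _ hT z hz

lemma exists_eq_comp_mor₃ (hT : Triangle.mk f g h ∈ distTriang T) (x : W ⟶ X⟦(1 : ℤ)⟧)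
    (hx : x ≫ f⟦(1 : ℤ)⟧' = 0) : ∃ z : W ⟶ Z, x = z ≫ h :=
  Triangle.coyoneda_exact₁ _ hT x hx

lemma exists_eq_comp_shift_mor₁ (hT : Triangle.mk f g h ∈ distTriang T) (y : W ⟶ Y⟦(1 : ℤ)⟧)
    (hy : y ≫ g⟦(1 : ℤ)⟧' = 0) : ∃ x : W ⟶ X⟦(1 : ℤ)⟧, y = x ≫ f⟦(1 : ℤ)⟧' := by
  obtain ⟨x, hx⟩ := Triangle.coyoneda_exact₁ _ (rot_of_distTriang _ hT) y hy
  exact ⟨-x, hx.trans ((Preadditive.comp_neg _ _).trans (Preadditive.neg_comp _ _).symm)⟩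

lemma eq_zero_of_comp_mor₁_eq_zero (hT : Triangle.mk f g h ∈ distTriang T)
    (hW : ∀ z : W⟦(1 : ℤ)⟧ ⟶ Z, z = 0) (x : W ⟶ X) (hx : x ≫ f = 0) : x = 0 := by
  apply (shiftFunctor T (1 : ℤ)).map_injective
  obtain ⟨z, hz⟩ := exists_eq_comp_mor₃ hT (x⟦(1 : ℤ)⟧') (by
    rw [← Functor.map_comp, hx, Functor.map_zero])
  rw [hz, hW z, zero_comp, Functor.map_zero]

end

/-- A countable coproduct of distinguished triangles is distinguished: the coproduct of the
first morphisms has the coproduct of the third objects as a cone. -/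
lemma exists_sigma_distTriang {A B G : ℕ → T} {a : ∀ i, A i ⟶ B i} {b : ∀ i, B i ⟶ G i}
    {c : ∀ i, G i ⟶ (A i)⟦(1 : ℤ)⟧} (hΔ : ∀ i, Triangle.mk (a i) (b i) (c i) ∈ distTriang T) :
    ∃ (g : ∐ B ⟶ ∐ G) (h : ∐ G ⟶ (∐ A)⟦(1 : ℤ)⟧),
      Triangle.mk (Limits.Sigma.map a) g h ∈ distTriang T := by
  obtain ⟨Z, f₂, f₃, hT⟩ := distinguished_cocone_triangle (Limits.Sigma.map a)
  have hφ : ∀ i, ∃ φ : G i ⟶ Z, b i ≫ φ = Sigma.ι B i ≫ f₂ ∧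
      c i ≫ (Sigma.ι A i)⟦(1 : ℤ)⟧' = φ ≫ f₃ := fun i =>
    complete_distinguished_triangle_morphism _ _ (hΔ i) hT (Sigma.ι A i) (Sigma.ι B i)
      (Sigma.ι_map a i).symm
  choose φ hφ₂ hφ₃ using hφ
  have inj : ∀ {W : T} (z : Z ⟶ W), (∀ i, φ i ≫ z = 0) → z = 0 := by
    intro W z hz
    obtain ⟨u, hu⟩ := exists_eq_mor₃_comp hT z (Sigma.hom_ext _ _ fun i => by
      rw [← reassoc_of% hφ₂ i, hz i, comp_zero, comp_zero])
    have hv : ∀ i, ∃ v : (B i)⟦(1 : ℤ)⟧ ⟶ W,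
        (Sigma.ι A i)⟦(1 : ℤ)⟧' ≫ u = (a i)⟦(1 : ℤ)⟧' ≫ v := fun i =>
      exists_eq_shift_mor₁_comp (hΔ i) _ (by rw [reassoc_of% hφ₃ i, ← hu, hz])
    choose v hv using hv
    obtain ⟨w, hw⟩ := exists_shift_sigma_desc v
    have huw : u = (Limits.Sigma.map a)⟦(1 : ℤ)⟧' ≫ w :=
      shift_sigma_hom_ext fun i => by
        rw [hv, ← hw, ← Functor.map_comp_assoc, ← Functor.map_comp_assoc, Sigma.ι_map]
    rw [hu, huw, reassoc_of% comp_eq_zero₃₁ hT, zero_comp]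
  have hk : ∃ k : Z ⟶ ∐ G, ∀ i, φ i ≫ k = Sigma.ι G i := by
    obtain ⟨z, hz⟩ := exists_eq_mor₂_comp hT (Limits.Sigma.map b)
      (Sigma.hom_ext _ _ fun i => by
        rw [Sigma.ι_map_assoc, Sigma.ι_map, reassoc_of% comp_eq_zero₁₂ (hΔ i), zero_comp,
          comp_zero])
    have hv : ∀ i, ∃ v : (A i)⟦(1 : ℤ)⟧ ⟶ ∐ G, Sigma.ι G i - φ i ≫ z = c i ≫ v := fun i =>
      exists_eq_mor₃_comp (hΔ i) _ (by
        rw [Preadditive.comp_sub, reassoc_of% hφ₂ i, ← hz, Sigma.ι_map, sub_self])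
    choose v hv using hv
    obtain ⟨w, hw⟩ := exists_shift_sigma_desc v
    refine ⟨z + f₃ ≫ w, fun i => ?_⟩
    rw [Preadditive.comp_add, ← reassoc_of% hφ₃ i, hw, ← hv, add_sub_cancel]
  obtain ⟨k, hk⟩ := hk
  let e : Z ≅ ∐ G :=
    { hom := k
      inv := Sigma.desc φ
      hom_inv_id := by
        rw [← sub_eq_zero]
        exact inj _ fun i => by rw [Preadditive.comp_sub, reassoc_of% hk i]; simp
      inv_hom_id := Sigma.hom_ext _ _ fun i => by simp [hk] }
  refine ⟨f₂ ≫ e.hom, e.inv ≫ f₃, isomorphic_distinguished _ hT _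
    (Triangle.isoMk _ _ (Iso.refl _) (Iso.refl _) e.symm ?_ ?_ ?_)⟩
  · exact (Category.comp_id _).trans (Category.id_comp _).symm
  · have h₂ : (f₂ ≫ e.hom) ≫ e.inv = f₂ := by simp
    exact h₂.trans (Category.id_comp f₂).symm
  · exact (congrArg ((e.inv ≫ f₃) ≫ ·) ((shiftFunctor T (1 : ℤ)).map_id _)).trans
      (Category.comp_id _)

/-- If coproducts of objects of `T^{≥ 0}` lie in `T^{≥ -r}`, then there are no morphisms from
`T^{≤ p}` to coproducts of objects of `T^{≥ k}` for `k > p + r`. -/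
lemma hom_sigma_eq_zero (t : TData T) {r : ℤ}
    (hcoprod : ∀ X : ℕ → T, (∀ i, X i ∈ t.ge 0) → (∐ X) ∈ t.ge (-r)) (k : ℕ) :
    ∀ {p : ℤ} (_ : p < k - r) {X : ℕ → T} (_ : ∀ i, X i ∈ t.ge k) {Y : T} (_ : Y ∈ t.le p)
      (f : Y ⟶ ∐ X), f = 0 := by
  induction k with
  | zero =>
    intro p hp X hX Y hY f
    exact t.hom_zero (by simpa using hp) hY (hcoprod X hX) f
  | succ k ih =>
    intro p hp X hX Y hY f
    apply (shiftFunctor T (1 : ℤ)).map_injective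
    rw [Functor.map_zero, ← cancel_mono (shiftSigmaIso X).hom, zero_comp]
    exact ih (p := p - 1) (by push_cast at hp; lia) (fun i => by simpa using t.ge_shift _ (hX i))
      (t.le_shift _ hY) _

lemma comp_truncLEπ_bijective (t : TData T) {n : ℤ} {Y : T} (hY : Y ∈ t.le n) (Z : T) :
    Function.Bijective fun y : Y ⟶ (t.truncLE n).obj Z => y ≫ (t.truncLEπ n).app Z := by
  obtain ⟨h, hT⟩ := t.trunc_triangle n Z
  constructor
  · intro y₁ y₂ hy
    rw [← sub_eq_zero]
    refine eq_zero_of_comp_mor₁_eq_zero hT (fun f => t.hom_zero (by lia) (t.le_shift _ hY)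
      (t.truncGE_mem (n + 1) Z) f) _ ?_
    exact (Preadditive.sub_comp _ _ _).trans (sub_eq_zero.2 hy)
  · intro z
    obtain ⟨y, hy⟩ := exists_eq_comp_mor₁ hT z
      (t.hom_zero (by lia) hY (t.truncGE_mem (n + 1) Z) _)
    exact ⟨y, hy.symm⟩

/-- A morphism induces an isomorphism on `(-)^{≤ n}` as soon as it induces bijections on morphisms
from the objects of `T^{≤ n}`. -/
lemma isIso_truncLE_map (t : TData T) {n : ℤ} {X Z : T} (f : X ⟶ Z)
    (hf : ∀ Y ∈ t.le n, Function.Bijective fun y : Y ⟶ X => y ≫ f) :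
    IsIso ((t.truncLE n).map f) := by
  have key : ∀ Y ∈ t.le n, Function.Bijective
      fun y : Y ⟶ (t.truncLE n).obj X => y ≫ (t.truncLE n).map f := fun Y hY => by
    rw [← (comp_truncLEπ_bijective t hY Z).of_comp_iff']
    have : (fun y : Y ⟶ (t.truncLE n).obj Z => y ≫ (t.truncLEπ n).app Z) ∘
        (fun y => y ≫ (t.truncLE n).map f) = (fun y => y ≫ f) ∘
          (fun y : Y ⟶ (t.truncLE n).obj X => y ≫ (t.truncLEπ n).app X) := by
      ext y
      simp
    rw [this]
    exact (hf Y hY).comp (comp_truncLEπ_bijective t hY X)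
  obtain ⟨g, hg⟩ := (key _ (t.truncLE_mem n Z)).2 (𝟙 _)
  dsimp only at hg
  refine ⟨g, (key _ (t.truncLE_mem n X)).1 ?_, hg⟩
  simp [hg]

/-- If the sequence `A^{≤ m}` is constant from `K` on and `m` is large with respect to `n`, then
`A_K ⟶ hocolim A` induces bijections on morphisms from the objects of `T^{≤ n}`. -/
lemma comp_ι_hocolim_bijective (t : TData T) {r : ℤ}
    (hcoprod : ∀ X : ℕ → T, (∀ i, X i ∈ t.ge 0) → (∐ X) ∈ t.ge (-r))
    (A : ℕ ⥤ T) {X : T} {π : (∐ fun i => A.obj i) ⟶ X} (hX : IsHocolim T A X π)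
    {n : ℤ} {m : ℕ} (hn : n < m) (hm : n < m - r) {K : ℕ}
    (hK : ∀ i j : ℕ, K ≤ i → ∀ h : i ≤ j, IsIso ((t.truncLE m).map (A.map (homOfLE h))))
    {Y : T} (hY : Y ∈ t.le n) :
    Function.Bijective fun y : Y ⟶ A.obj K => y ≫ Sigma.ι (fun i => A.obj i) K ≫ π := by
  obtain ⟨w, hw⟩ := hX
  choose δ hδ using fun i => t.trunc_triangle m (A.obj i)
  obtain ⟨g, h, hT⟩ := exists_sigma_distTriang hδ
  let C : ℕ ⥤ T := A ⋙ t.truncLE m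
  obtain ⟨c, s, hc₁, hc₂, hs₁, hs₂⟩ := exists_splitting_of_stable C K hK
  let e : (∐ fun i => C.obj i) ⟶ ∐ fun i => A.obj i :=
    Limits.Sigma.map fun i => (t.truncLEπ m).app (A.obj i)
  change Triangle.mk e g h ∈ distTriang T at hT
  have hιe : ∀ i, Sigma.ι (fun i => C.obj i) i ≫ e =
      (t.truncLEπ m).app (A.obj i) ≫ Sigma.ι (fun i => A.obj i) i := fun i => by simp [e]
  have hde : (𝟙 _ - seqShift T C) ≫ e = e ≫ (𝟙 _ - seqShift T A) := by
    refine Sigma.hom_ext _ _ fun i => ?_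
    simp only [Preadditive.sub_comp, Preadditive.comp_sub, reassoc_of% ι_seqShift, Category.id_comp,
      Category.comp_id, hιe, reassoc_of% hιe, ι_seqShift]
    simp [C]
  have hdπ : (𝟙 _ - seqShift T A) ≫ π = 0 := comp_distTriang_mor_zero₁₂ _ hw
  have hG : ∀ i, (t.truncGE (m + 1)).obj (A.obj i) ∈ t.ge ((m + 1 : ℕ) : ℤ) := fun i => by
    simpa using t.truncGE_mem (m + 1) (A.obj i)
  have hom₀ : ∀ f : Y ⟶ ∐ fun i => (t.truncGE (m + 1)).obj (A.obj i), f = 0 :=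
    hom_sigma_eq_zero t hcoprod (m + 1) (by push_cast; lia) hG hY
  have hom₁ : ∀ f : Y⟦(1 : ℤ)⟧ ⟶ ∐ fun i => (t.truncGE (m + 1)).obj (A.obj i), f = 0 :=
    hom_sigma_eq_zero t hcoprod (m + 1) (by push_cast; lia) hG (t.le_shift _ hY)
  have hom₂ : ∀ f : Y ⟶ (∐ fun i => (t.truncGE (m + 1)).obj (A.obj i))⟦(1 : ℤ)⟧, f = 0 :=
      fun f => by
    rw [← cancel_mono (shiftSigmaIso _).hom, zero_comp]
    exact hom_sigma_eq_zero t hcoprod m hm (fun i => by simpa using t.ge_shift _ (hG i)) hY _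
  have lift : ∀ f : Y ⟶ ∐ fun i => A.obj i, ∃ f' : Y ⟶ ∐ fun i => C.obj i, f = f' ≫ e :=
    fun f => exists_eq_comp_mor₁ hT f (hom₀ _)
  have hcπ : c ≫ Sigma.ι (fun i => C.obj i) K ≫ e ≫ π = e ≫ π :=
    hs₂ _ (by rw [reassoc_of% hde, hdπ, comp_zero])
  constructor
  · intro x₁ x₂ hx
    rw [← sub_eq_zero] at hx ⊢
    dsimp only at hx
    rw [← Preadditive.sub_comp] at hx
    obtain ⟨x', hx'⟩ := exists_eq_comp_mor₁ (hδ K) (x₁ - x₂)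
      (t.hom_zero (by lia) hY (t.truncGE_mem (m + 1) _) _)
    obtain ⟨y, hy⟩ := exists_eq_comp_mor₁ hw
      ((x₁ - x₂) ≫ Sigma.ι (fun i => A.obj i) K) (by rw [Category.assoc, hx])
    obtain ⟨y', rfl⟩ := lift y
    have h₀ : x' ≫ Sigma.ι (fun i => C.obj i) K = y' ≫ (𝟙 _ - seqShift T C) := by
      rw [← sub_eq_zero]
      refine eq_zero_of_comp_mor₁_eq_zero hT hom₁ _ ?_
      rw [Preadditive.sub_comp, Category.assoc, Category.assoc, hιe, hde, sub_eq_zero,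
        ← Category.assoc y', ← hy, hx', Category.assoc]
    have h₁ : x' = 0 := by
      have h₂ := h₀ =≫ c
      rw [Category.assoc, Category.assoc, hc₁, hc₂, comp_zero] at h₂
      exact (Category.comp_id x').symm.trans h₂
    rw [hx', h₁, zero_comp]
  · intro f
    have hfw : f ≫ w = 0 := by
      obtain ⟨u, hu⟩ := exists_eq_comp_shift_mor₁ hT (f ≫ w) (hom₂ _)
      have hud : u ≫ (𝟙 _ - seqShift T C)⟦(1 : ℤ)⟧' = 0 := by
        obtain ⟨z, hz⟩ := exists_eq_comp_mor₃ hT (u ≫ (𝟙 _ - seqShift T C)⟦(1 : ℤ)⟧') (by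
          rw [Category.assoc, ← Functor.map_comp, hde, Functor.map_comp, ← Category.assoc, ← hu,
            Category.assoc, comp_eq_zero₃₁ hw, comp_zero])
        rw [hz, hom₀ z, zero_comp]
      have hu₀ : u = 0 := by
        have := hud =≫ s⟦(1 : ℤ)⟧'
        rwa [Category.assoc, ← Functor.map_comp, hs₁, CategoryTheory.Functor.map_id,
          Category.comp_id, zero_comp] at this
      rw [hu, hu₀, zero_comp]
    obtain ⟨y, hy⟩ := exists_eq_comp_mor₂ hw f hfw
    obtain ⟨y', rfl⟩ := lift y
    refine ⟨y' ≫ c ≫ (t.truncLEπ m).app (A.obj K), ?_⟩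
    dsimp only
    rw [hy, Category.assoc, Category.assoc, Category.assoc, ← reassoc_of% hιe, hcπ]

end

/-- Lemma 95.11: if countable coproducts of objects of `T^{≥0}` lie in
`T^{≥ -r}` and `A` is a sequence whose truncations `A^{≤ n}` all eventually stabilize,
then for each `n` the natural map `colim A^{≤ n} ⟶ (hocolim A)^{≤ n}` — identified,
at any stabilization index `N`, with the truncation of `A_N ⟶ hocolim A` — is an
isomorphism. -/
theorem statement14 (t : TData T) (r : ℤ) (hr : 0 < r)
    (hcoprod : ∀ X : ℕ → T, (∀ i, X i ∈ t.ge 0) → (∐ X) ∈ t.ge (-r))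
    (A : ℕ ⥤ T)
    (hstab : ∀ n : ℤ, ∃ N : ℕ, ∀ i j : ℕ, N ≤ i → ∀ h : i ≤ j,
      IsIso ((t.truncLE n).map (A.map (homOfLE h))))
    (X : T) (π : (∐ fun i => A.obj i) ⟶ X) (hX : IsHocolim T A X π)
    (n : ℤ) (N : ℕ)
    (hN : ∀ i j : ℕ, N ≤ i → ∀ h : i ≤ j,
      IsIso ((t.truncLE n).map (A.map (homOfLE h)))) :
    IsIso ((t.truncLE n).map (Sigma.ι (fun i => A.obj i) N ≫ π)) := by
  let m : ℕ := (n + r).toNat + 1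
  obtain ⟨K, hK⟩ := hstab m
  have hdπ : (𝟙 _ - seqShift T A) ≫ π = 0 := comp_eq_zero₁₂ hX.choose_spec
  have := hN N (max K N) le_rfl (le_max_right K N)
  have : IsIso ((t.truncLE n).map (Sigma.ι (fun i => A.obj i) (max K N) ≫ π)) :=
    isIso_truncLE_map t _ fun Y hY =>
      comp_ι_hocolim_bijective t hcoprod A hX (m := m) (by lia) (by lia)
        (fun i j hi h => hK i j (le_trans (le_max_left K N) hi) h) hY
  rw [← ι_comp_eq_of_sub_seqShift_comp_eq_zero A π hdπ (le_max_right K N), Functor.map_comp]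
  infer_instance

end Paper
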